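/- arXiv:1901.00852 — 2 statements merged into one kernel-verified Lean document; each statement's English description precedes it below -/
import Mathlib

section
/- Uniform convergence of multivariate Bernstein polynomials: Let f : [0,1]^n -> R be continuous. Then the multivariate Bernstein polynomials B_{m_1,...,m_n}(f) converge uniformly to f on [0,1]^n as m_1, ..., m_n all tend to infinity; that is, for every epsilon > 0 there exists M such that whenever m_1 >= M, ..., m_n >= M, one has |B_{m_1,...,m_n}(f)(x) - f(x)| < epsilon for all x in [0,1]^n. -/
open Finset

/-- The multivariate Bernstein polynomial of `f : [0,1]ⁿ → ℝ` with degrees `m₁, …, mₙ`: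
`B_{m₁,…,mₙ}(f)(x) = ∑_{0 ≤ kⱼ ≤ mⱼ} f(k₁/m₁, …, kₙ/mₙ) ∏ⱼ C(mⱼ,kⱼ) xⱼ^{kⱼ} (1-xⱼ)^{mⱼ-kⱼ}`. -/
noncomputable def mvBernstein {n : ℕ} (m : Fin n → ℕ) (f : (Fin n → ℝ) → ℝ)
    (x : Fin n → ℝ) : ℝ :=
  ∑ k ∈ Fintype.piFinset (fun j => Finset.range (m j + 1)),
    f (fun j => (k j : ℝ) / (m j : ℝ)) *
      ∏ j, (((m j).choose (k j) : ℝ) * x j ^ (k j) * (1 - x j) ^ (m j - k j))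

/-- The value at `x` of the `k`-th Bernstein basis polynomial of degree `m`. -/
noncomputable def bernsteinWeight (m : ℕ) (x : ℝ) (k : ℕ) : ℝ :=
  (m.choose k : ℝ) * x ^ k * (1 - x) ^ (m - k)

theorem bernsteinWeight_nonneg (m : ℕ) {x : ℝ} (hx : x ∈ Set.Icc (0 : ℝ) 1) (k : ℕ) :
    0 ≤ bernsteinWeight m x k := by
  have h₀ : 0 ≤ x := hx.1
  have h₁ : 0 ≤ 1 - x := sub_nonneg.2 hx.2
  unfold bernsteinWeight
  positivity

theorem sum_bernsteinWeight (m : ℕ) (x : ℝ) :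
    ∑ k ∈ range (m + 1), bernsteinWeight m x k = 1 := by
  have h := congrArg (Polynomial.eval x) (bernsteinPolynomial.sum ℝ m)
  simpa [Polynomial.eval_finsetSum, bernsteinPolynomial, bernsteinWeight] using h

theorem sum_sq_mul_bernsteinWeight {m : ℕ} (hm : m ≠ 0) {x : ℝ} (hx : x ∈ Set.Icc (0 : ℝ) 1) :
    ∑ k ∈ range (m + 1), (x - k / m) ^ 2 * bernsteinWeight m x k = x * (1 - x) / m := by
  have h := bernstein.variance hm ⟨x, hx⟩
  simpa [bernstein_apply, bernstein.z, sum_range, bernsteinWeight] using h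

/-- The expectation of a function of one coordinate under a product of Bernstein weights is its
expectation under the weights of that coordinate. -/
theorem sum_piFinset_mul_prod_bernsteinWeight {ι : Type*} [Fintype ι] [DecidableEq ι]
    (m : ι → ℕ) (x : ι → ℝ) (i : ι) (g : ℕ → ℝ) :
    ∑ k ∈ Fintype.piFinset (fun j => range (m j + 1)),
        g (k i) * ∏ j, bernsteinWeight (m j) (x j) (k j) =
      ∑ a ∈ range (m i + 1), g a * bernsteinWeight (m i) (x i) a := by
  have h := prod_univ_sum (fun j => range (m j + 1))
    (fun j a => (if j = i then g a else 1) * bernsteinWeight (m j) (x j) a)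
  simp only [prod_mul_distrib, prod_ite_eq', mem_univ, if_true] at h
  rw [← h, prod_eq_single i]
  · simp
  · intro j _ hj
    simp [hj, sum_bernsteinWeight]
  · simp

theorem sum_piFinset_prod_bernsteinWeight {ι : Type*} [Fintype ι] [DecidableEq ι]
    (m : ι → ℕ) (x : ι → ℝ) :
    ∑ k ∈ Fintype.piFinset (fun j => range (m j + 1)),
      ∏ j, bernsteinWeight (m j) (x j) (k j) = 1 := by
  rw [← prod_univ_sum (fun j => range (m j + 1)) (fun j => bernsteinWeight (m j) (x j))]
  simp [sum_bernsteinWeight]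

/-- On a compact set, a continuous function has a modulus of continuity that is quadratic up to
an arbitrarily small additive error. -/
theorem IsCompact.exists_abs_sub_le_add_mul_sum_sq {ι : Type*} [Fintype ι] {s : Set (ι → ℝ)}
    (hs : IsCompact s) {f : (ι → ℝ) → ℝ} (hf : ContinuousOn f s) {ε : ℝ} (hε : 0 < ε) :
    ∃ K : ℝ, 0 ≤ K ∧ ∀ x ∈ s, ∀ y ∈ s, |f y - f x| ≤ ε + K * ∑ j, (x j - y j) ^ 2 := by
  obtain ⟨C, hC⟩ := hs.exists_bound_of_continuousOn hf
  obtain ⟨δ, hδ, hfδ⟩ := Metric.uniformContinuousOn_iff.1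
    (hs.uniformContinuousOn_of_continuous hf) ε hε
  refine ⟨2 * |C| / δ ^ 2, by positivity, fun x hx y hy => ?_⟩
  have hsum : 0 ≤ ∑ j, (x j - y j) ^ 2 := sum_nonneg fun j _ => sq_nonneg _
  by_cases hxy : dist y x < δ
  · have h := (hfδ y hy x hx hxy).le
    rw [Real.dist_eq] at h
    have : 0 ≤ 2 * |C| / δ ^ 2 * ∑ j, (x j - y j) ^ 2 := by positivity
    linarith
  · rw [dist_pi_lt_iff hδ] at hxy
    push Not at hxy
    obtain ⟨i, hi⟩ := hxy
    rw [Real.dist_eq, abs_sub_comm] at hi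
    have hδi : δ ^ 2 ≤ ∑ j, (x j - y j) ^ 2 := calc
      δ ^ 2 ≤ (x i - y i) ^ 2 := by
        rw [← sq_abs (x i - y i)]
        gcongr
      _ ≤ _ := single_le_sum (f := fun j => (x j - y j) ^ 2)
        (fun j _ => sq_nonneg _) (mem_univ i)
    have hfxy : |f y - f x| ≤ 2 * |C| := by
      have hfx := (hC x hx).trans (le_abs_self C)
      have hfy := (hC y hy).trans (le_abs_self C)
      rw [Real.norm_eq_abs] at hfx hfy
      linarith [abs_sub (f y) (f x)]
    have : 2 * |C| ≤ 2 * |C| / δ ^ 2 * ∑ j, (x j - y j) ^ 2 := calc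
      2 * |C| = 2 * |C| / δ ^ 2 * δ ^ 2 := by field_simp
      _ ≤ _ := by gcongr
    linarith

/-- **Uniform convergence of multivariate Bernstein polynomials.**  If `f` is continuous on
`[0,1]ⁿ`, then for every `ε > 0` there is `M` such that whenever all degrees `mⱼ ≥ M`
(`mⱼ` positive), `|B_{m₁,…,mₙ}(f)(x) - f(x)| < ε` for all `x ∈ [0,1]ⁿ`. -/
theorem bernstein_uniform_convergence {n : ℕ} (f : (Fin n → ℝ) → ℝ)
    (hf : ContinuousOn f (Set.Icc (0 : Fin n → ℝ) 1)) :
    ∀ ε > (0 : ℝ), ∃ M : ℕ, 0 < M ∧ ∀ m : Fin n → ℕ, (∀ j, M ≤ m j) →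
      ∀ x ∈ Set.Icc (0 : Fin n → ℝ) 1, |mvBernstein m f x - f x| < ε := by
  intro ε hε
  obtain ⟨K, hK, hfK⟩ := isCompact_Icc.exists_abs_sub_le_add_mul_sum_sq hf (half_pos hε)
  obtain ⟨N, hN⟩ := exists_nat_gt (K * n / (ε / 2))
  refine ⟨N + 1, N.succ_pos, fun m hm x hx => ?_⟩
  have hxj (j : Fin n) : x j ∈ Set.Icc (0 : ℝ) 1 := ⟨hx.1 j, hx.2 j⟩
  set S := Fintype.piFinset (fun j => range (m j + 1))
  set W : (Fin n → ℕ) → ℝ := fun k => ∏ j, bernsteinWeight (m j) (x j) (k j) with hW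
  have hW₀ (k : Fin n → ℕ) : 0 ≤ W k :=
    prod_nonneg fun j _ => bernsteinWeight_nonneg _ (hxj j) _
  have hW₁ : ∑ k ∈ S, W k = 1 := sum_piFinset_prod_bernsteinWeight m x
  have hB : mvBernstein m f x - f x = ∑ k ∈ S, (f (fun j => (k j : ℝ) / m j) - f x) * W k := by
    simp only [sub_mul, sum_sub_distrib, ← mul_sum, hW₁, mul_one]
    rfl
  have hvar (i : Fin n) : ∑ k ∈ S, (x i - (k i : ℝ) / m i) ^ 2 * W k ≤ 1 / (N + 1) := by
    have hmi : ((N : ℝ) + 1) ≤ m i := mod_cast hm i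
    rw [hW, sum_piFinset_mul_prod_bernsteinWeight m x i (fun a => (x i - (a : ℝ) / m i) ^ 2),
      sum_sq_mul_bernsteinWeight (by have := hm i; lia) (hxj i)]
    have : x i * (1 - x i) ≤ 1 := by nlinarith [sq_nonneg (x i - 1 / 2)]
    gcongr
  calc |mvBernstein m f x - f x|
      ≤ ∑ k ∈ S, |f (fun j => (k j : ℝ) / m j) - f x| * W k := by
        rw [hB]
        refine (abs_sum_le_sum_abs _ _).trans_eq (sum_congr rfl fun k _ => ?_)
        rw [abs_mul, abs_of_nonneg (hW₀ k)]
    _ ≤ ∑ k ∈ S, (ε / 2 + K * ∑ j, (x j - (k j : ℝ) / m j) ^ 2) * W k := by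
        refine sum_le_sum fun k hk => mul_le_mul_of_nonneg_right (hfK x hx _ ?_) (hW₀ k)
        refine ⟨fun j => by simp only [Pi.zero_apply]; positivity, fun j => ?_⟩
        have hkj : k j ≤ m j := Nat.lt_succ_iff.1 (mem_range.1 (Fintype.mem_piFinset.1 hk j))
        exact div_le_one_of_le₀ (Nat.cast_le.2 hkj) (Nat.cast_nonneg _)
    _ = ε / 2 + K * ∑ j, ∑ k ∈ S, (x j - (k j : ℝ) / m j) ^ 2 * W k := by
        rw [sum_comm]
        simp only [add_mul, sum_add_distrib, mul_assoc, ← mul_sum, ← sum_mul, hW₁, mul_one]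
    _ ≤ ε / 2 + K * ∑ _j : Fin n, (1 / (N + 1) : ℝ) := by
        gcongr with j
        exact hvar j
    _ < ε := by
        rw [div_lt_iff₀ (half_pos hε)] at hN
        have : K * ∑ _j : Fin n, (1 / (N + 1) : ℝ) < ε / 2 := by
          simp only [sum_const, card_univ, Fintype.card_fin, nsmul_eq_mul]
          rw [← mul_assoc, mul_one_div, div_lt_iff₀ (by positivity)]
          linarith
        linarith
end

section
/- Taylor-certificate criterion for local dissipativity: Let f : R^n x R^m -> R^n and h : R^n x R^m -> R^p be k times continuously differentiable with f(0,0) = 0 and h(0,0) = 0. Let X = {x in R^n : g_i(x) <= 0, i = 1,...,I_X} and U = {u in R^m : g'_j(u) <= 0, j = 1,...,I_U} for polynomials g_i, g'_j, and let w(u, y) be a polynomial supply rate. For each component write f_i(x,u) = p_i(x,u) + sum over multi-index pairs (beta_1, beta_2) with |beta_1| + |beta_2| = k of R_{i;beta_1,beta_2}(x,u) * x^{beta_1} * u^{beta_2}, where p_i is the Taylor polynomial of f_i of order k-1 at (0,0), and similarly h_j(x,u) = q_j(x,u) + sum over (delta_1, delta_2) with |delta_1| + |delta_2| = k of T_{j;delta_1,delta_2}(x,u)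 * x^{delta_1} * u^{delta_2}; assume constants rbar_{i;beta_1,beta_2} and tbar_{j;delta_1,delta_2} satisfy |R_{i;beta_1,beta_2}(x,u)| <= rbar_{i;beta_1,beta_2} and |T_{j;delta_1,delta_2}(x,u)| <= tbar_{j;delta_1,delta_2} for all (x,u) in X x U. Suppose there exist a polynomial V(x) and nonnegative polynomials s_{1;i}(x), s_{2;i,beta_1,beta_2}, s_{3;i,beta_1,beta_2}, s_{4;j,delta_1,delta_2}, s_{5;j,delta_1,delta_2}, s_{6;i}(x,u), s_{7;j}(x,u) such that, for all real x, u and all real scalars r_{i;beta_1,beta_2}, t_{j;delta_1,delta_2}: (a) V(x) + sum_i s_{1;i}(x) g_i(x) >= 0, and (b) - sum over i = 1,...,n of (partial V / partial x_i)(x) * ( p_i(x,u) + sum_{|beta_1|+|beta_2|=k} r_{i;beta_1,beta_2} x^{beta_1} u^{beta_2} ) + w(u, yhat) - sum over i, (beta_1,beta_2) of [ s_{2;i,beta_1,beta_2} (rbar_{i;beta_1,beta_2} - r_{i;beta_1,beta_2}) + s_{3;i,beta_1,beta_2} (rbar_{i;beta_1,beta_2} + r_{i;beta_1,beta_2}) ]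 - sum over j, (delta_1,delta_2) of [ s_{4;j,delta_1,delta_2} (tbar_{j;delta_1,delta_2} - t_{j;delta_1,delta_2}) + s_{5;j,delta_1,delta_2} (tbar_{j;delta_1,delta_2} + t_{j;delta_1,delta_2}) ] + sum_i s_{6;i}(x,u) g_i(x) + sum_j s_{7;j}(x,u) g'_j(u) >= 0, where yhat is the vector with components yhat_j = q_j(x,u) + sum_{|delta_1|+|delta_2|=k} t_{j;delta_1,delta_2} x^{delta_1} u^{delta_2}. Then V(x) >= 0 for all x in X, and along every trajectory of x' = f(x,u), y = h(x,u) whose input satisfies u(t) in U for all t and whose state satisfies x(t) in X for all t, the dissipation inequality V(x(t_1)) - V(x(t_0)) <= integral from t_0 to t_1 of w(u(t), y(t)) dt holds for all t_0 <= t_1. -/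
open Finset

/-- Partial derivative of `g : ℝⁿ → ℝ` in the `j`-th coordinate direction. -/
noncomputable def pder {n : ℕ} (j : Fin n) (g : (Fin n → ℝ) → ℝ) : (Fin n → ℝ) → ℝ :=
  fun x => deriv (fun t : ℝ => g (Function.update x j t)) (x j)

/-- Iterated partial derivative `D^α g` for a multi-index `α : Fin n → ℕ`. -/
noncomputable def mder {n : ℕ} (α : Fin n → ℕ) (g : (Fin n → ℝ) → ℝ) : (Fin n → ℝ) → ℝ :=
  (List.finRange n).foldr (fun j h => (pder j)^[α j] h) g

/-- Mixed iterated partial derivative `D^α_x D^β_u g` of a two-argument function. -/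
noncomputable def mder2 {n m : ℕ} (α : Fin n → ℕ) (β : Fin m → ℕ)
    (g : (Fin n → ℝ) → (Fin m → ℝ) → ℝ) (x : Fin n → ℝ) (u : Fin m → ℝ) : ℝ :=
  mder β (fun v => mder α (fun z => g z v) x) u

/-- Multi-index factorial `α! = α₁! ⋯ αₙ!`. -/
def mfact {n : ℕ} (α : Fin n → ℕ) : ℕ := ∏ j, Nat.factorial (α j)

/-- Multi-index power `x^α = x₁^{α₁} ⋯ xₙ^{αₙ}`. -/
def mpow {n : ℕ} (x : Fin n → ℝ) (α : Fin n → ℕ) : ℝ := ∏ j, x j ^ α j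

/-- Pairs of multi-indices `(α, β)` with `|α| + |β| ≤ d`. -/
def pairLe (n m d : ℕ) : Finset ((Fin n → ℕ) × (Fin m → ℕ)) :=
  (((Fintype.piFinset fun _ => Finset.range (d + 1)) ×ˢ
      (Fintype.piFinset fun _ => Finset.range (d + 1))).filter
    fun ab => (∑ j, ab.1 j) + (∑ j, ab.2 j) ≤ d)

/-- Pairs of multi-indices `(α, β)` with `|α| + |β| = d`. -/
def pairEq (n m d : ℕ) : Finset ((Fin n → ℕ) × (Fin m → ℕ)) :=
  (((Fintype.piFinset fun _ => Finset.range (d + 1)) ×ˢ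
      (Fintype.piFinset fun _ => Finset.range (d + 1))).filter
    fun ab => (∑ j, ab.1 j) + (∑ j, ab.2 j) = d)

/-- The Taylor polynomial of order `d` of `g(x,u)` at `(0,0)`:
`∑_{|α|+|β| ≤ d} (D^α_x D^β_u g(0,0) / (α! β!)) x^α u^β`. -/
noncomputable def taylorPoly2 {n m : ℕ} (d : ℕ)
    (g : (Fin n → ℝ) → (Fin m → ℝ) → ℝ) (x : Fin n → ℝ) (u : Fin m → ℝ) : ℝ :=
  ∑ ab ∈ pairLe n m d,
    mder2 ab.1 ab.2 g 0 0 / ((mfact ab.1 : ℝ) * (mfact ab.2 : ℝ)) *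
      mpow x ab.1 * mpow u ab.2

/-- `g : ℝⁿ → ℝ` is a polynomial function. -/
def IsPolyFun {n : ℕ} (g : (Fin n → ℝ) → ℝ) : Prop :=
  ∃ q : MvPolynomial (Fin n) ℝ, ∀ x, g x = MvPolynomial.eval x q

/-- `g : ℝⁿ × ℝᵐ → ℝ` is a polynomial function. -/
def IsPolyFun2 {n m : ℕ} (g : (Fin n → ℝ) → (Fin m → ℝ) → ℝ) : Prop :=
  ∃ q : MvPolynomial (Fin n ⊕ Fin m) ℝ, ∀ x u, g x u = MvPolynomial.eval (Sum.elim x u) q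

/-- Polynomial functions are differentiable. -/
theorem IsPolyFun.differentiable {n : ℕ} {g : (Fin n → ℝ) → ℝ} (hg : IsPolyFun g) :
    Differentiable ℝ g := by
  obtain ⟨q, hq⟩ := hg
  rw [show g = fun x => MvPolynomial.eval x q from funext hq]
  clear hq
  induction q using MvPolynomial.induction_on with
  | C a => simp
  | add p q hp hq => simpa using! hp.add hq
  | mul_X p i hp => simpa using! hp.mul (differentiable_apply i)

/-- Partial derivatives are values of the total derivative at the standard basis vectors. -/
theorem DifferentiableAt.pder_eq_fderiv {n : ℕ} {g : (Fin n → ℝ) → ℝ} {x : Fin n → ℝ}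
    (hg : DifferentiableAt ℝ g x) (i : Fin n) :
    pder i g x = fderiv ℝ g x (Pi.single i 1) := by
  have hgx : HasFDerivAt g (fderiv ℝ g x) (Function.update x i (x i)) := by
    simpa using hg.hasFDerivAt
  exact (hgx.comp_hasDerivAt (x i) (hasDerivAt_update x i (x i))).deriv

/-- The chain rule along a curve, in terms of partial derivatives. -/
theorem DifferentiableAt.hasDerivAt_comp_curve {n : ℕ} {g : (Fin n → ℝ) → ℝ}
    {c : ℝ → Fin n → ℝ} {v : Fin n → ℝ} {t : ℝ}
    (hg : DifferentiableAt ℝ g (c t)) (hc : HasDerivAt c v t) :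
    HasDerivAt (fun s => g (c s)) (∑ i, pder i g (c t) * v i) t := by
  refine (hg.hasFDerivAt.comp_hasDerivAt t hc).congr_deriv ?_
  conv_lhs => rw [pi_eq_sum_univ' v, map_sum]
  refine Finset.sum_congr rfl fun i _ => ?_
  rw [hg.pder_eq_fderiv, map_smul, smul_eq_mul, mul_comm]

/-- Nonnegative multipliers of nonpositive constraints sum to a nonpositive value. -/
theorem sum_mul_nonpos {N : ℕ} {s g : Fin N → ℝ} (hs : ∀ i, 0 ≤ s i) (hg : ∀ i, g i ≤ 0) :
    ∑ i, s i * g i ≤ 0 :=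
  Finset.sum_nonpos fun i _ => mul_nonpos_of_nonneg_of_nonpos (hs i) (hg i)

/-- The multiplier terms of the two-sided bounds `|r i a| ≤ b i a` are nonnegative. -/
theorem sum_sum_mul_bound_nonneg {N : ℕ} {A : Type*} {S : Finset A} {s s' b r : Fin N → A → ℝ}
    (hs : ∀ i a, 0 ≤ s i a) (hs' : ∀ i a, 0 ≤ s' i a)
    (hr : ∀ i, ∀ a ∈ S, |r i a| ≤ b i a) :
    0 ≤ ∑ i, ∑ a ∈ S, (s i a * (b i a - r i a) + s' i a * (b i a + r i a)) := by
  refine Finset.sum_nonneg fun i _ => Finset.sum_nonneg fun a ha => ?_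
  obtain ⟨hl, hu⟩ := abs_le.mp (hr i a ha)
  exact add_nonneg (mul_nonneg (hs i a) (by linarith)) (mul_nonneg (hs' i a) (by linarith))

/-- **Taylor-certificate criterion for local dissipativity.** -/
theorem taylor_certificate_local_dissipativity
    {n m p k IX IU : ℕ} (hk : 0 < k)
    (f : (Fin n → ℝ) → (Fin m → ℝ) → (Fin n → ℝ))
    (h : (Fin n → ℝ) → (Fin m → ℝ) → (Fin p → ℝ))
    (hf : ContDiff ℝ ((k : ℕ) : ℕ∞) (Function.uncurry f))
    (hh : ContDiff ℝ ((k : ℕ) : ℕ∞) (Function.uncurry h))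
    (hf0 : f 0 0 = 0) (hh0 : h 0 0 = 0)
    -- the semialgebraic constraint sets `X = {x | gX i x ≤ 0}`, `U = {u | gU j u ≤ 0}`
    (gX : Fin IX → (Fin n → ℝ) → ℝ) (hgX : ∀ i, IsPolyFun (gX i))
    (gU : Fin IU → (Fin m → ℝ) → ℝ) (hgU : ∀ j, IsPolyFun (gU j))
    -- the polynomial supply rate
    (w : (Fin m → ℝ) → (Fin p → ℝ) → ℝ) (hw : IsPolyFun2 w)
    -- Taylor decomposition of `f` and `h` with remainder coefficient functions `R`, `T`
    (R : Fin n → ((Fin n → ℕ) × (Fin m → ℕ)) → (Fin n → ℝ) → (Fin m → ℝ) → ℝ)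
    (hfdec : ∀ i x u, f x u i =
      taylorPoly2 (k - 1) (fun a b => f a b i) x u +
        ∑ ab ∈ pairEq n m k, R i ab x u * mpow x ab.1 * mpow u ab.2)
    (T : Fin p → ((Fin n → ℕ) × (Fin m → ℕ)) → (Fin n → ℝ) → (Fin m → ℝ) → ℝ)
    (hhdec : ∀ j x u, h x u j =
      taylorPoly2 (k - 1) (fun a b => h a b j) x u +
        ∑ ab ∈ pairEq n m k, T j ab x u * mpow x ab.1 * mpow u ab.2)
    -- uniform bounds on the remainder coefficients over `X × U`
    (rbar : Fin n → ((Fin n → ℕ) × (Fin m → ℕ)) → ℝ)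
    (hrbar : ∀ i, ∀ ab ∈ pairEq n m k, ∀ x, (∀ i', gX i' x ≤ 0) →
      ∀ u, (∀ j', gU j' u ≤ 0) → |R i ab x u| ≤ rbar i ab)
    (tbar : Fin p → ((Fin n → ℕ) × (Fin m → ℕ)) → ℝ)
    (htbar : ∀ j, ∀ ab ∈ pairEq n m k, ∀ x, (∀ i', gX i' x ≤ 0) →
      ∀ u, (∀ j', gU j' u ≤ 0) → |T j ab x u| ≤ tbar j ab)
    -- the storage function candidate and the nonnegative polynomial multipliers
    (V : (Fin n → ℝ) → ℝ) (hV : IsPolyFun V)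
    (s₁ : Fin IX → (Fin n → ℝ) → ℝ)
    (hs₁ : ∀ i, IsPolyFun (s₁ i) ∧ ∀ x, 0 ≤ s₁ i x)
    (s₂ s₃ : Fin n → ((Fin n → ℕ) × (Fin m → ℕ)) →
      (Fin n → ℝ) → (Fin m → ℝ) → ℝ)
    (hs₂ : ∀ i ab, IsPolyFun2 (s₂ i ab) ∧ ∀ x u, 0 ≤ s₂ i ab x u)
    (hs₃ : ∀ i ab, IsPolyFun2 (s₃ i ab) ∧ ∀ x u, 0 ≤ s₃ i ab x u)
    (s₄ s₅ : Fin p → ((Fin n → ℕ) × (Fin m → ℕ)) →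
      (Fin n → ℝ) → (Fin m → ℝ) → ℝ)
    (hs₄ : ∀ j ab, IsPolyFun2 (s₄ j ab) ∧ ∀ x u, 0 ≤ s₄ j ab x u)
    (hs₅ : ∀ j ab, IsPolyFun2 (s₅ j ab) ∧ ∀ x u, 0 ≤ s₅ j ab x u)
    (s₆ : Fin IX → (Fin n → ℝ) → (Fin m → ℝ) → ℝ)
    (hs₆ : ∀ i, IsPolyFun2 (s₆ i) ∧ ∀ x u, 0 ≤ s₆ i x u)
    (s₇ : Fin IU → (Fin n → ℝ) → (Fin m → ℝ) → ℝ)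
    (hs₇ : ∀ j, IsPolyFun2 (s₇ j) ∧ ∀ x u, 0 ≤ s₇ j x u)
    -- certificate condition (a)
    (ha : ∀ x : Fin n → ℝ, 0 ≤ V x + ∑ i, s₁ i x * gX i x)
    -- certificate condition (b)
    (hb : ∀ (x : Fin n → ℝ) (u : Fin m → ℝ)
        (r : Fin n → ((Fin n → ℕ) × (Fin m → ℕ)) → ℝ)
        (t : Fin p → ((Fin n → ℕ) × (Fin m → ℕ)) → ℝ),
      0 ≤
        -(∑ i, pder i V x *
            (taylorPoly2 (k - 1) (fun a b => f a b i) x u +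
              ∑ ab ∈ pairEq n m k, r i ab * mpow x ab.1 * mpow u ab.2)) +
          w u (fun j =>
            taylorPoly2 (k - 1) (fun a b => h a b j) x u +
              ∑ ab ∈ pairEq n m k, t j ab * mpow x ab.1 * mpow u ab.2) -
          (∑ i, ∑ ab ∈ pairEq n m k,
            (s₂ i ab x u * (rbar i ab - r i ab) + s₃ i ab x u * (rbar i ab + r i ab))) -
          (∑ j, ∑ ab ∈ pairEq n m k,
            (s₄ j ab x u * (tbar j ab - t j ab) + s₅ j ab x u * (tbar j ab + t j ab))) +
          (∑ i, s₆ i x u * gX i x) + ∑ j, s₇ j x u * gU j u) :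
    -- conclusion: `V ≥ 0` on `X`, and the dissipation inequality holds along every
    -- trajectory staying in `X` with input in `U`
    (∀ x : Fin n → ℝ, (∀ i, gX i x ≤ 0) → 0 ≤ V x) ∧
      ∀ (xtr : ℝ → (Fin n → ℝ)) (utr : ℝ → (Fin m → ℝ)),
        (∀ t, HasDerivAt xtr (f (xtr t) (utr t)) t) →
        (∀ t j, gU j (utr t) ≤ 0) →
        (∀ t i, gX i (xtr t) ≤ 0) →
        ∀ t₀ t₁ : ℝ, t₀ ≤ t₁ →
        IntervalIntegrable (fun t => w (utr t) (h (xtr t) (utr t)))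
          MeasureTheory.volume t₀ t₁ →
        V (xtr t₁) - V (xtr t₀) ≤ ∫ t in t₀..t₁, w (utr t) (h (xtr t) (utr t)) := by
  refine ⟨fun x hx => ?_, fun xtr utr hder hU hX t₀ t₁ hle hint => ?_⟩
  · linarith [ha x, sum_mul_nonpos (fun i => (hs₁ i).2 x) hx]
  have hderV (t : ℝ) : HasDerivAt (fun s => V (xtr s))
      (∑ i, pder i V (xtr t) * f (xtr t) (utr t) i) t :=
    (hV.differentiable (xtr t)).hasDerivAt_comp_curve (hder t)
  refine intervalIntegral.sub_le_integral_of_hasDeriv_right_of_le hle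
    (fun t _ => (hderV t).continuousAt.continuousWithinAt)
    (fun t _ => (hderV t).hasDerivWithinAt)
    ((intervalIntegrable_iff_integrableOn_Icc_of_le hle).mp hint) fun t _ => ?_
  set x := xtr t
  set u := utr t
  have hcert := hb x u (fun i ab => R i ab x u) (fun j ab => T j ab x u)
  simp only [← hfdec, ← hhdec] at hcert
  have hr := sum_sum_mul_bound_nonneg (fun i ab => (hs₂ i ab).2 x u) (fun i ab => (hs₃ i ab).2 x u)
    fun i ab hab => hrbar i ab hab x (hX t) u (hU t)
  have ht := sum_sum_mul_bound_nonneg (fun j ab => (hs₄ j ab).2 x u) (fun j ab => (hs₅ j ab).2 x u)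
    fun j ab hab => htbar j ab hab x (hX t) u (hU t)
  have hgx := sum_mul_nonpos (fun i => (hs₆ i).2 x u) (hX t)
  have hgu := sum_mul_nonpos (fun j => (hs₇ j).2 x u) (hU t)
  linarith
end
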